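/- arXiv:2103.02888 — 2 statements merged into one kernel-verified Lean document; each statement's English description precedes it below -/
import Mathlib

section
/- A divergence-free Hamiltonian partner is a symmetry: Let U ⊆ ℝ³ be open, B, J : U → ℝ³ continuously differentiable, and p : U → ℝ twice continuously differentiable. If div B = 0 on U, div J = 0 on U, and J × B = ∇p on U, then the Lie bracket [B, J] vanishes identically on U, i.e. (fderiv ℝ J z)(B(z)) − (fderiv ℝ B z)(J(z)) = 0 for all z ∈ U. -/
noncomputable section

open RealInnerProductSpace

/-- `ℝ³` as a Euclidean space. -/
abbrev R3 : Type := EuclideanSpace ℝ (Fin 3)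

/-- The point `(x, y, z)` of `ℝ³`. -/
def pt (x y z : ℝ) : R3 := !₂[x, y, z]

/-- Divergence of a vector field: the trace of its derivative. -/
def divg (v : R3 → R3) (z : R3) : ℝ :=
  LinearMap.trace ℝ R3 (fderiv ℝ v z).toLinearMap

/-- Cross product on `ℝ³`. -/
def cross3 (u v : R3) : R3 :=
  pt (u 1 * v 2 - u 2 * v 1) (u 2 * v 0 - u 0 * v 2) (u 0 * v 1 - u 1 * v 0)

/-- Standard basis vectors of `ℝ³`. -/
def e3 (i : Fin 3) : R3 := EuclideanSpace.single i 1

/-- Curl of a vector field on `ℝ³`. -/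
def curl (v : R3 → R3) (z : R3) : R3 :=
  pt (fderiv ℝ v z (e3 1) 2 - fderiv ℝ v z (e3 2) 1)
     (fderiv ℝ v z (e3 2) 0 - fderiv ℝ v z (e3 0) 2)
     (fderiv ℝ v z (e3 0) 1 - fderiv ℝ v z (e3 1) 0)

/-- The Hessian of `p` at `z`, as a bilinear form. -/
def hess (p : R3 → ℝ) (z : R3) (u v : R3) : ℝ :=
  (iteratedFDeriv ℝ 2 p z) ![u, v]

/-- `γ` is the image of a periodic integral curve of `B` lying in `U`. -/
def IsPeriodicOrbit (U : Set R3) (B : R3 → R3) (γ : Set R3) : Prop :=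
  ∃ (c : ℝ → R3) (T : ℝ), 0 < T ∧ (∀ t, c t ∈ U) ∧
    (∀ t, c (t + T) = c t) ∧ (∀ t, HasDerivAt c (B (c t)) t) ∧ Set.range c = γ

/-- An integrable magnetic field `(B, J, p)` on an open set `U ⊆ ℝ³`. -/
structure IntegrableMagneticField (U : Set R3) (B J : R3 → R3) (p : R3 → ℝ) : Prop where
  isOpen_U : IsOpen U
  smooth_B : ContDiffOn ℝ (⊤ : ℕ∞) B U
  smooth_J : ContDiffOn ℝ (⊤ : ℕ∞) J U
  smooth_p : ContDiffOn ℝ (⊤ : ℕ∞) p U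
  B_ne_zero : ∀ z ∈ U, B z ≠ 0
  div_B : ∀ z ∈ U, divg B z = 0
  div_J : ∀ z ∈ U, divg J z = 0
  hamiltonian : ∀ z ∈ U, cross3 (J z) (B z) = gradient p z

/-- A nondegenerate elliptic magnetic axis: a compact image of a periodic integral
curve of `B` on which `∇p = 0` and the Hessian of `p`, restricted to the plane
orthogonal to `B`, is positive or negative definite. -/
def IsNondegenerateEllipticAxis (U : Set R3) (B : R3 → R3) (p : R3 → ℝ)
    (γ : Set R3) : Prop :=
  IsCompact γ ∧ γ ⊆ U ∧ IsPeriodicOrbit U B γ ∧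
  (∀ z ∈ γ, gradient p z = 0) ∧
  ∀ z ∈ γ,
    (∀ u : R3, u ≠ 0 → ⟪u, B z⟫ = 0 → 0 < hess p z u u) ∨
    (∀ u : R3, u ≠ 0 → ⟪u, B z⟫ = 0 → hess p z u u < 0)

/-- The solid cylinder `D_r × ℝ = {(x,y,φ) : x² + y² < r²}` in `ℝ³`. -/
def Dset (r : ℝ) : Set R3 := {q | (q 0) ^ 2 + (q 1) ^ 2 < r ^ 2}

lemma divg_eq_sum (v : R3 → R3) (z : R3) :
    divg v z = ∑ i, fderiv ℝ v z (e3 i) i := by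
  rw [divg, LinearMap.trace_eq_matrix_trace ℝ (EuclideanSpace.basisFun (Fin 3) ℝ).toBasis,
    Matrix.trace]
  simp [LinearMap.toMatrix_apply, e3]

lemma clm_apply_eq_sum (L : R3 →L[ℝ] R3) (v : R3) (i : Fin 3) :
    L v i = ∑ j, v j * L (e3 j) i := by
  have hv : v = ∑ j, v j • e3 j := by
    ext k
    fin_cases k <;> simp [e3, Fin.sum_univ_three]
  conv_lhs => rw [hv]
  simp

lemma gradient_apply (p : R3 → ℝ) (x : R3) (i : Fin 3) :
    gradient p x i = fderiv ℝ p x (e3 i) := by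
  have h := InnerProductSpace.toDual_symm_apply (𝕜 := ℝ) (x := e3 i) (y := fderiv ℝ p x)
  rw [← h, e3, EuclideanSpace.inner_single_right]
  simp [gradient]

/-- The mixed partial derivatives of `p` agree, phrased through the gradient. -/
lemma fderiv_gradient_symm {p : R3 → ℝ} {z : R3} (hp : ContDiffAt ℝ 2 p z) (i j : Fin 3) :
    fderiv ℝ (fun x => gradient p x i) z (e3 j) =
      fderiv ℝ (fun x => gradient p x j) z (e3 i) := by
  have hd : DifferentiableAt ℝ (fderiv ℝ p) z :=
    (hp.fderiv_right (m := 1) (by norm_num)).differentiableAt (by norm_num)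
  have key : ∀ i j, fderiv ℝ (fun x => gradient p x i) z (e3 j) =
      fderiv ℝ (fderiv ℝ p) z (e3 j) (e3 i) := by
    intro i j
    simp only [gradient_apply]
    rw [fderiv_clm_apply hd (by fun_prop)]
    simp
  rw [key, key]
  exact hp.isSymmSndFDerivAt (by simp) _ _

lemma fderiv_mul_sub_mul {u v : R3 → R3} {z : R3} (hu : DifferentiableAt ℝ u z)
    (hv : DifferentiableAt ℝ v z) (a b : Fin 3) (w : R3) :
    fderiv ℝ (fun x => u x a * v x b - u x b * v x a) z w =
      fderiv ℝ u z w a * v z b + u z a * fderiv ℝ v z w b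
        - (fderiv ℝ u z w b * v z a + u z b * fderiv ℝ v z w a) := by
  have cu : ∀ i, HasFDerivAt (fun x => u x i) (EuclideanSpace.proj i ∘L fderiv ℝ u z) z :=
    fun i => (EuclideanSpace.proj (𝕜 := ℝ) i).hasFDerivAt.comp z hu.hasFDerivAt
  have cv : ∀ i, HasFDerivAt (fun x => v x i) (EuclideanSpace.proj i ∘L fderiv ℝ v z) z :=
    fun i => (EuclideanSpace.proj (𝕜 := ℝ) i).hasFDerivAt.comp z hv.hasFDerivAt
  have h : HasFDerivAt (fun x => u x a * v x b - u x b * v x a) _ z :=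
    ((cu a).mul (cv b)).sub ((cu b).mul (cv a))
  rw [h.fderiv]
  simp
  ring

/-- **A divergence-free Hamiltonian partner is a symmetry**: if `div B = 0`,
`div J = 0` and `J × B = ∇p` on an open set, then `[B, J] = 0` there. -/
theorem bracket_vanishes_of_divergence_free
    (U : Set R3) (hU : IsOpen U)
    (B J : R3 → R3) (p : R3 → ℝ)
    (hB : ContDiffOn ℝ 1 B U) (hJ : ContDiffOn ℝ 1 J U)
    (hp : ContDiffOn ℝ 2 p U)
    (hdivB : ∀ z ∈ U, divg B z = 0)
    (hdivJ : ∀ z ∈ U, divg J z = 0)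
    (hJB : ∀ z ∈ U, cross3 (J z) (B z) = gradient p z) :
    ∀ z ∈ U, (fderiv ℝ J z) (B z) - (fderiv ℝ B z) (J z) = 0 := by
  intro z hz
  have hUz := hU.mem_nhds hz
  have dB := (hB.contDiffAt hUz).differentiableAt one_ne_zero
  have dJ := (hJ.contDiffAt hUz).differentiableAt one_ne_zero
  have hsymm := fderiv_gradient_symm (hp.contDiffAt hUz)
  have hgrad : ∀ i, (fun x => gradient p x i) =ᶠ[nhds z] fun x => cross3 (J x) (B x) i := by
    intro i
    filter_upwards [hUz] with x hx
    rw [hJB x hx]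
  simp only [(hgrad _).fderiv_eq] at hsymm
  have h01 := hsymm 0 1
  have h02 := hsymm 0 2
  have h12 := hsymm 1 2
  have c0 : ∀ u v : R3, cross3 u v 0 = u 1 * v 2 - u 2 * v 1 := fun _ _ => rfl
  have c1 : ∀ u v : R3, cross3 u v 1 = u 2 * v 0 - u 0 * v 2 := fun _ _ => rfl
  have c2 : ∀ u v : R3, cross3 u v 2 = u 0 * v 1 - u 1 * v 0 := fun _ _ => rfl
  simp only [c0, c1, c2, fderiv_mul_sub_mul dJ dB] at h01 h02 h12
  have tB := hdivB z hz
  have tJ := hdivJ z hz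
  rw [divg_eq_sum, Fin.sum_univ_three] at tB tJ
  ext i
  rw [PiLp.sub_apply, clm_apply_eq_sum, clm_apply_eq_sum, Fin.sum_univ_three,
    Fin.sum_univ_three, PiLp.zero_apply]
  fin_cases i <;> simp only [Fin.zero_eta, Fin.mk_one, Fin.reduceFinMk]
  · linear_combination (B z 0) * tJ - (J z 0) * tB - h12
  · linear_combination (B z 1) * tJ - (J z 1) * tB + h02
  · linear_combination (B z 2) * tJ - (J z 2) * tB - h01
end
end

section
/- Nondegeneracy of the coisotropic η-embedding symplectic form at the zero section (pointwise content of Theorem 4.2): Let B, e ∈ ℝ³ with ⟪e, B⟫ ≠ 0. Define the bilinear form ω on ℝ³ × ℝ by ω((v,s),(w,t)) := ⟪B, v × w⟫ + s·⟪e, w⟫ − t·⟪e, v⟫. Then ω is nondegenerate: if (v,s) ∈ ℝ³ × ℝ satisfies ω((v,s),(w,t)) = 0 for all (w,t) ∈ ℝ³ × ℝ, then v = 0 and s = 0. -/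
noncomputable section

open RealInnerProductSpace

theorem inner_R3_eq (u v : R3) : ⟪u, v⟫ = u 0 * v 0 + u 1 * v 1 + u 2 * v 2 := by
  simp only [PiLp.inner_apply, Fin.sum_univ_three, RCLike.inner_apply, conj_trivial]
  ring

theorem inner_cross3_eq (B v w : R3) :
    ⟪B, cross3 v w⟫ = B 0 * (v 1 * w 2 - v 2 * w 1) + B 1 * (v 2 * w 0 - v 0 * w 2)
      + B 2 * (v 0 * w 1 - v 1 * w 0) := by
  simp [inner_R3_eq, cross3, pt]

theorem inner_cross3_self_right (B v : R3) : ⟪B, cross3 v B⟫ = 0 := by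
  rw [inner_cross3_eq]
  ring

/-- The kernel of the flux two-form of `B` consists of vectors parallel to `B`. -/
theorem inner_smul_eq_of_inner_cross3_eq_zero {B v : R3} (h : ∀ w, ⟪B, cross3 v w⟫ = 0) (e : R3) :
    ⟪e, B⟫ • v = ⟪e, v⟫ • B := by
  have h0 := h (e3 0)
  have h1 := h (e3 1)
  have h2 := h (e3 2)
  simp [inner_cross3_eq, e3] at h0 h1 h2
  ext i
  simp only [PiLp.smul_apply, smul_eq_mul, inner_R3_eq]
  fin_cases i <;> simp only [Fin.zero_eta, Fin.mk_one, Fin.reduceFinMk]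
  · linear_combination e 2 * h1 - e 1 * h2
  · linear_combination e 0 * h2 - e 2 * h0
  · linear_combination e 1 * h0 - e 0 * h1

/-- **Nondegeneracy of the coisotropic η-embedding symplectic form at the zero
section** (pointwise content of Theorem 4.2). -/
theorem eta_embedding_form_nondegenerate
    (B e : R3) (he : ⟪e, B⟫ ≠ 0) (v : R3) (s : ℝ)
    (h : ∀ (w : R3) (t : ℝ),
      ⟪B, cross3 v w⟫ + s * ⟪e, w⟫ - t * ⟪e, v⟫ = 0) :
    v = 0 ∧ s = 0 := by
  have hs : s = 0 := by
    simpa [inner_cross3_self_right, he] using h B 0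
  subst hs
  have hev : ⟪e, v⟫ = 0 := by
    simpa [inner_cross3_eq] using h 0 1
  have hker : ∀ w, ⟪B, cross3 v w⟫ = 0 := fun w => by
    simpa using h w 0
  have hv := inner_smul_eq_of_inner_cross3_eq_zero hker e
  rw [hev, zero_smul] at hv
  exact ⟨(smul_eq_zero.mp hv).resolve_left he, rfl⟩
end
end
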